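/- arXiv:2603.29839 — 2 statements merged into one kernel-verified Lean document; each statement's English description precedes it below -/
import Mathlib

section
/- For every real t > 0 and every real θ > 0, the identity Σ_{n=1}^∞ n e^{−t(n²−1)/4} sinh(nθ)/sinh(θ) = (2√π e^{t/4}/t^{3/2}) · (1/sinh θ) · Σ_{m∈ℤ} (θ − 2πim) e^{(θ−2πim)²/t} holds, where the left-hand side is an absolutely convergent series of real numbers, the right-hand side is an absolutely convergent series of complex numbers, and the asserted equality is between the real number on the left and the complex number on the right (which is in fact real). -/
open scoped Real

/-- The theta-function term at `z = -iθ/(2π)`, `τ = it/(4π)` is a real Gaussian exponential. -/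
lemma jacobiTheta₂_term_eq_exp_ofReal (t θ : ℝ) (n : ℤ) :
    jacobiTheta₂_term n (-Complex.I * θ / (2 * π)) (Complex.I * t / (4 * π))
      = ((Real.exp (n * θ - t * n ^ 2 / 4) : ℝ) : ℂ) := by
  have hπ : (π : ℂ) ≠ 0 := by exact_mod_cast Real.pi_ne_zero
  rw [jacobiTheta₂_term, Complex.ofReal_exp]
  congr 1
  push_cast
  field_simp
  linear_combination (-(4 * n * θ) + t * n ^ 2 : ℂ) * Complex.I_sq

/-- Completing the square in the theta-function term at `z = -2θ/t`, `τ = 4πi/t`. -/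
lemma exp_sq_div_mul_jacobiTheta₂_term {t : ℝ} (ht : t ≠ 0) (θ : ℝ) (m : ℤ) :
    Complex.exp ((θ : ℂ) ^ 2 / t)
        * jacobiTheta₂_term m (-2 * θ / t) (4 * π * Complex.I / t)
      = Complex.exp (((θ : ℂ) - 2 * (π : ℂ) * Complex.I * (m : ℂ)) ^ 2 / (t : ℂ)) := by
  have htC : (t : ℂ) ≠ 0 := by exact_mod_cast ht
  rw [jacobiTheta₂_term, ← Complex.exp_add]
  congr 1
  field_simp
  ring

/-- The Poisson-dual Gaussian series, expressed through the theta function and its derivative. -/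
lemma hasSum_mul_exp_sq_div {t : ℝ} (ht : 0 < t) (θ : ℝ) :
    HasSum (fun m : ℤ => ((θ : ℂ) - 2 * (π : ℂ) * Complex.I * (m : ℂ))
        * Complex.exp (((θ : ℂ) - 2 * (π : ℂ) * Complex.I * (m : ℂ)) ^ 2 / (t : ℂ)))
      (Complex.exp ((θ : ℂ) ^ 2 / t)
        * (θ * jacobiTheta₂ (-2 * θ / t) (4 * π * Complex.I / t)
          - jacobiTheta₂' (-2 * θ / t) (4 * π * Complex.I / t))) := by
  have him : 0 < (4 * (π : ℂ) * Complex.I / t).im := by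
    have h : (4 * (π : ℂ) * Complex.I / t) = ((4 * π / t : ℝ) : ℂ) * Complex.I := by
      push_cast; ring
    rw [h, Complex.im_ofReal_mul, Complex.I_im, mul_one]
    positivity
  refine HasSum.congr_fun ((((hasSum_jacobiTheta₂_term (-2 * θ / t : ℂ) him).mul_left (θ : ℂ)).sub
    (hasSum_jacobiTheta₂'_term (-2 * θ / t : ℂ) him)).mul_left
      (Complex.exp ((θ : ℂ) ^ 2 / t))) fun m => ?_
  rw [← exp_sq_div_mul_jacobiTheta₂_term ht.ne', jacobiTheta₂'_term]
  ring

/-- Poisson summation for the Gaussian series with a linear weight. -/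
lemma hasSum_int_mul_exp {t : ℝ} (ht : 0 < t) (θ : ℝ) :
    HasSum (fun n : ℤ => (n : ℂ) * ((Real.exp (n * θ - t * n ^ 2 / 4) : ℝ) : ℂ))
      (((4 * √π / t ^ ((3 : ℝ) / 2) : ℝ) : ℂ)
        * ∑' m : ℤ, ((θ : ℂ) - 2 * (π : ℂ) * Complex.I * (m : ℂ))
            * Complex.exp (((θ : ℂ) - 2 * (π : ℂ) * Complex.I * (m : ℂ)) ^ 2 / (t : ℂ))) := by
  have hπ : (π : ℂ) ≠ 0 := by exact_mod_cast Real.pi_ne_zero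
  have htC : (t : ℂ) ≠ 0 := by exact_mod_cast ht.ne'
  have hI := Complex.I_ne_zero
  have him : 0 < (Complex.I * t / (4 * π) : ℂ).im := by
    have h : (Complex.I * t / (4 * π) : ℂ) = ((t / (4 * π) : ℝ) : ℂ) * Complex.I := by
      push_cast; ring
    rw [h, Complex.im_ofReal_mul, Complex.I_im, mul_one]
    positivity
  have hsum := (hasSum_jacobiTheta₂'_term (-Complex.I * θ / (2 * π)) him).mul_left
    (1 / (2 * π * Complex.I))
  have hpow : (-Complex.I * (Complex.I * t / (4 * π))) ^ (1 / 2 : ℂ)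
      = ((√t / (2 * √π) : ℝ) : ℂ) := by
    have hbase : -Complex.I * (Complex.I * t / (4 * π)) = ((t / (4 * π) : ℝ) : ℂ) := by
      push_cast
      linear_combination (-(t / (4 * π)) : ℂ) * Complex.I_sq
    have hhalf : (1 / 2 : ℂ) = ((1 / 2 : ℝ) : ℂ) := by push_cast; rfl
    rw [hbase, hhalf, ← Complex.ofReal_cpow (by positivity), ← Real.sqrt_eq_rpow,
      Real.sqrt_div ht.le, Real.sqrt_mul (by norm_num),
      show (4 : ℝ) = 2 ^ 2 by norm_num, Real.sqrt_sq (by norm_num)]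
  have ht32 : t ^ ((3 : ℝ) / 2) = t * √t := by
    rw [show (3 : ℝ) / 2 = 1 + 1 / 2 by norm_num, Real.rpow_add ht, Real.rpow_one,
      Real.sqrt_eq_rpow]
  have hz : -Complex.I * θ / (2 * π) / (Complex.I * t / (4 * π)) = -2 * θ / (t : ℂ) := by
    field_simp
    ring
  have hτ : -1 / (Complex.I * t / (4 * π)) = 4 * π * Complex.I / (t : ℂ) := by
    field_simp
    linear_combination (-1 : ℂ) * Complex.I_sq
  have hexp : -π * Complex.I * (-Complex.I * θ / (2 * π)) ^ 2 / (Complex.I * t / (4 * π))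
      = (θ : ℂ) ^ 2 / t := by
    field_simp
    linear_combination (-4 * θ ^ 2 : ℂ) * Complex.I_sq
  have hst : ((√t : ℝ) : ℂ) ≠ 0 := by exact_mod_cast (Real.sqrt_pos.mpr ht).ne'
  have hsπ : ((√π : ℝ) : ℂ) ≠ 0 := by exact_mod_cast (Real.sqrt_pos.mpr Real.pi_pos).ne'
  rw [jacobiTheta₂'_functional_equation, hpow, hz, hτ, hexp] at hsum
  rw [(hasSum_mul_exp_sq_div ht θ).tsum_eq, ht32]
  have hval (A B C : ℂ) : ((4 * √π / (t * √t) : ℝ) : ℂ) * (A * (θ * B - C))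
      = 1 / (2 * π * Complex.I) * (1 / ((√t / (2 * √π) : ℝ) : ℂ) * A
        / (Complex.I * t / (4 * π))
          * (C - 2 * π * Complex.I * (-Complex.I * θ / (2 * π)) * B)) := by
    push_cast
    field_simp
    linear_combination (-(A * C)) * Complex.I_sq
  rw [hval]
  refine hsum.congr_fun fun n => ?_
  rw [jacobiTheta₂'_term, jacobiTheta₂_term_eq_exp_ofReal]
  field_simp

/-- The coherent-state norm series converges to half of the symmetric series over `ℤ`. -/
lemma hasSum_coherent_norm {t θ : ℝ} {S : ℂ}
    (h : HasSum (fun n : ℤ => (n : ℂ) * ((Real.exp (n * θ - t * n ^ 2 / 4) : ℝ) : ℂ)) S) :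
    HasSum (fun n : ℕ => ((((n : ℝ) + 1) * Real.exp (-t * (((n : ℝ) + 1) ^ 2 - 1) / 4)
        * Real.sinh (((n : ℝ) + 1) * θ) / Real.sinh θ : ℝ) : ℂ))
      ((Real.exp (t / 4) / (2 * Real.sinh θ) : ℝ) * S) := by
  have hnat := (hasSum_nat_add_iff' 1).mpr h.nat_add_neg
  simp only [Finset.sum_range_one, Nat.cast_zero, Int.cast_zero, neg_zero, zero_mul, add_zero,
    sub_zero] at hnat
  refine (hnat.mul_left ((Real.exp (t / 4) / (2 * Real.sinh θ) : ℝ) : ℂ)).congr_fun fun n => ?_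
  have hE : Real.exp (-t * (((n : ℝ) + 1) ^ 2 - 1) / 4)
      = Real.exp (t / 4) * Real.exp (-(t * ((n : ℝ) + 1) ^ 2 / 4)) := by
    rw [← Real.exp_add]
    congr 1
    ring
  have hp : Real.exp (((n : ℝ) + 1) * θ - t * ((n : ℝ) + 1) ^ 2 / 4)
      = Real.exp (((n : ℝ) + 1) * θ) * Real.exp (-(t * ((n : ℝ) + 1) ^ 2 / 4)) := by
    rw [← Real.exp_add]
    congr 1
  have hm : Real.exp (-((n : ℝ) + 1) * θ - t * (-((n : ℝ) + 1)) ^ 2 / 4)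
      = Real.exp (-(((n : ℝ) + 1) * θ)) * Real.exp (-(t * ((n : ℝ) + 1) ^ 2 / 4)) := by
    rw [← Real.exp_add]
    congr 1
    ring
  have key : ((n : ℝ) + 1) * Real.exp (-t * (((n : ℝ) + 1) ^ 2 - 1) / 4)
        * Real.sinh (((n : ℝ) + 1) * θ) / Real.sinh θ
      = Real.exp (t / 4) / (2 * Real.sinh θ)
        * (((n : ℝ) + 1) * Real.exp (((n : ℝ) + 1) * θ - t * ((n : ℝ) + 1) ^ 2 / 4)
          + -((n : ℝ) + 1)
            * Real.exp (-((n : ℝ) + 1) * θ - t * (-((n : ℝ) + 1)) ^ 2 / 4)) := by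
    rw [hE, hp, hm, Real.sinh_eq (((n : ℝ) + 1) * θ)]
    ring
  rw [key]
  push_cast
  ring

/-- **Poisson resummation of the SU(2) heat-kernel coherent state norm.**
For every `t > 0` and `θ > 0`, the series
`Σ_{n=1}^∞ n e^{−t(n²−1)/4} sinh(nθ)/sinh(θ)` of real numbers converges absolutely,
the series `Σ_{m∈ℤ} (θ − 2πim) e^{(θ−2πim)²/t}` of complex numbers converges absolutely,
and the real number given by the first series equals (as a complex number) the complex number
`(2√π e^{t/4}/t^{3/2}) · (1/sinh θ)` times the second series. -/
theorem poisson_resummation_coherent_norm (t θ : ℝ) (ht : 0 < t) (hθ : 0 < θ) :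
    Summable (fun n : ℕ => |(((n : ℝ) + 1) * Real.exp (-t * (((n : ℝ) + 1) ^ 2 - 1) / 4)
        * Real.sinh (((n : ℝ) + 1) * θ) / Real.sinh θ)|) ∧
    Summable (fun m : ℤ => ‖((θ : ℂ) - 2 * (π : ℂ) * Complex.I * (m : ℂ))
        * Complex.exp (((θ : ℂ) - 2 * (π : ℂ) * Complex.I * (m : ℂ)) ^ 2 / (t : ℂ))‖) ∧
    ((∑' n : ℕ, ((n : ℝ) + 1) * Real.exp (-t * (((n : ℝ) + 1) ^ 2 - 1) / 4)
        * Real.sinh (((n : ℝ) + 1) * θ) / Real.sinh θ : ℝ) : ℂ)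
      = ((2 * Real.sqrt π * Real.exp (t / 4) / t ^ ((3 : ℝ) / 2) : ℝ) : ℂ)
        * (1 / (Real.sinh θ : ℂ))
        * ∑' m : ℤ, ((θ : ℂ) - 2 * (π : ℂ) * Complex.I * (m : ℂ))
            * Complex.exp (((θ : ℂ) - 2 * (π : ℂ) * Complex.I * (m : ℂ)) ^ 2 / (t : ℂ)) := by
  have hL := hasSum_coherent_norm (hasSum_int_mul_exp ht θ)
  refine ⟨(Complex.summable_ofReal.mp hL.summable).abs,
    (hasSum_mul_exp_sq_div ht θ).summable.norm, ?_⟩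
  rw [Complex.ofReal_tsum, hL.tsum_eq]
  push_cast
  ring
end

section
/- For every real t > 0, the function G : (0, ∞) → ℂ defined by G(θ) = (1/sinh θ) Σ_{m∈ℤ} (θ − 2πim) e^{(θ−2πim)²/t} is differentiable on (0, ∞), and its derivative is given by termwise differentiation: G′(θ) = Σ_{m∈ℤ} e^{(θ−2πim)²/t} [ 2(θ−2πim)²/(t sinh θ) − (θ−2πim) cosh θ / sinh²θ + 1/sinh θ ], where this last series converges absolutely for every θ > 0. -/
open scoped Real

lemma summable_add_pow_mul_exp_neg_sq {t : ℝ} (ht : 0 < t) {R : ℝ} (hR : 0 ≤ R) (k : ℕ) :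
    Summable (fun m : ℤ =>
      (R + 2 * π * |(m : ℝ)|) ^ k * Real.exp ((R ^ 2 - 4 * π ^ 2 * (m : ℝ) ^ 2) / t)) := by
  have hT : 0 < 4 * π / t := by positivity
  have h₀ := summable_pow_mul_jacobiTheta₂_term_bound 0 hT 0
  have hk := summable_pow_mul_jacobiTheta₂_term_bound 0 hT k
  refine Summable.of_nonneg_of_le (fun m => by positivity) (fun m => ?_)
    ((h₀.mul_left (2 ^ (k - 1) * R ^ k * Real.exp (R ^ 2 / t))).add
      (hk.mul_left (2 ^ (k - 1) * (2 * π) ^ k * Real.exp (R ^ 2 / t))))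
  have hexp : Real.exp ((R ^ 2 - 4 * π ^ 2 * (m : ℝ) ^ 2) / t) = Real.exp (R ^ 2 / t) *
      Real.exp (-π * (4 * π / t * (m : ℝ) ^ 2 - 2 * 0 * |(m : ℝ)|)) := by
    rw [← Real.exp_add]
    congr 1
    ring
  have hpow := add_pow_le hR (by positivity : 0 ≤ 2 * π * |(m : ℝ)|) k
  push_cast
  rw [hexp]
  refine (mul_le_mul_of_nonneg_right hpow (by positivity)).trans_eq ?_
  rw [mul_pow]
  ring

lemma norm_pow_mul_cexp_sq_le {t : ℝ} (ht : 0 < t) {R x : ℝ} (hx : |x| ≤ R) (k : ℕ) (m : ℤ) :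
    ‖((x : ℂ) - 2 * (π : ℂ) * Complex.I * (m : ℂ)) ^ k
        * Complex.exp (((x : ℂ) - 2 * (π : ℂ) * Complex.I * (m : ℂ)) ^ 2 / (t : ℂ))‖
      ≤ (R + 2 * π * |(m : ℝ)|) ^ k * Real.exp ((R ^ 2 - 4 * π ^ 2 * (m : ℝ) ^ 2) / t) := by
  have hR : 0 ≤ R := (abs_nonneg x).trans hx
  have hre : (((x : ℂ) - 2 * (π : ℂ) * Complex.I * (m : ℂ)) ^ 2 / (t : ℂ)).re
      = (x ^ 2 - 4 * π ^ 2 * (m : ℝ) ^ 2) / t := by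
    rw [Complex.div_ofReal_re]
    simp [pow_two]
    ring
  have hnorm : ‖(x : ℂ) - 2 * (π : ℂ) * Complex.I * (m : ℂ)‖ ≤ R + 2 * π * |(m : ℝ)| := by
    refine (norm_sub_le _ _).trans ?_
    simpa [abs_of_pos Real.pi_pos] using hx
  have hsq : x ^ 2 ≤ R ^ 2 := sq_le_sq' (abs_le.mp hx).1 (abs_le.mp hx).2
  rw [norm_mul, norm_pow, Complex.norm_exp, hre]
  gcongr

lemma summable_pow_mul_cexp_sq {t : ℝ} (ht : 0 < t) (x : ℝ) (k : ℕ) :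
    Summable (fun m : ℤ => ((x : ℂ) - 2 * (π : ℂ) * Complex.I * (m : ℂ)) ^ k
        * Complex.exp (((x : ℂ) - 2 * (π : ℂ) * Complex.I * (m : ℂ)) ^ 2 / (t : ℂ))) :=
  (summable_add_pow_mul_exp_neg_sq ht (abs_nonneg x) k).of_norm_bounded
    (norm_pow_mul_cexp_sq_le ht le_rfl k)

lemma hasDerivAt_mul_cexp_sq (t x : ℝ) (m : ℤ) :
    HasDerivAt (fun y : ℝ => ((y : ℂ) - 2 * (π : ℂ) * Complex.I * (m : ℂ))
        * Complex.exp (((y : ℂ) - 2 * (π : ℂ) * Complex.I * (m : ℂ)) ^ 2 / (t : ℂ)))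
      (((x : ℂ) - 2 * (π : ℂ) * Complex.I * (m : ℂ)) ^ 0
          * Complex.exp (((x : ℂ) - 2 * (π : ℂ) * Complex.I * (m : ℂ)) ^ 2 / (t : ℂ))
        + 2 / (t : ℂ) * (((x : ℂ) - 2 * (π : ℂ) * Complex.I * (m : ℂ)) ^ 2
          * Complex.exp (((x : ℂ) - 2 * (π : ℂ) * Complex.I * (m : ℂ)) ^ 2 / (t : ℂ)))) x := by
  have hw : HasDerivAt (fun y : ℝ => (y : ℂ) - 2 * (π : ℂ) * Complex.I * (m : ℂ)) 1 x :=
    (Complex.ofRealCLM.hasDerivAt (x := x)).sub_const _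
  refine (hw.fun_mul ((hw.fun_pow 2).div_const (t : ℂ)).cexp).congr_deriv ?_
  push_cast
  ring

lemma hasDerivAt_tsum_mul_cexp_sq {t : ℝ} (ht : 0 < t) (x : ℝ) :
    HasDerivAt (fun y : ℝ => ∑' m : ℤ, ((y : ℂ) - 2 * (π : ℂ) * Complex.I * (m : ℂ))
        * Complex.exp (((y : ℂ) - 2 * (π : ℂ) * Complex.I * (m : ℂ)) ^ 2 / (t : ℂ)))
      (∑' m : ℤ, (((x : ℂ) - 2 * (π : ℂ) * Complex.I * (m : ℂ)) ^ 0
          * Complex.exp (((x : ℂ) - 2 * (π : ℂ) * Complex.I * (m : ℂ)) ^ 2 / (t : ℂ))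
        + 2 / (t : ℂ) * (((x : ℂ) - 2 * (π : ℂ) * Complex.I * (m : ℂ)) ^ 2
          * Complex.exp (((x : ℂ) - 2 * (π : ℂ) * Complex.I * (m : ℂ)) ^ 2 / (t : ℂ))))) x := by
  have hR : 0 ≤ |x| + 1 := by positivity
  have hxR : x ∈ Metric.ball (0 : ℝ) (|x| + 1) := by simp
  refine hasDerivAt_tsum_of_isPreconnected
    ((summable_add_pow_mul_exp_neg_sq ht hR 0).add
      ((summable_add_pow_mul_exp_neg_sq ht hR 2).mul_left ‖2 / (t : ℂ)‖))
    Metric.isOpen_ball (convex_ball (0 : ℝ) (|x| + 1)).isPreconnected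
    (fun m y _ => hasDerivAt_mul_cexp_sq t y m) (fun m y hy => ?_) hxR
    (by simpa using summable_pow_mul_cexp_sq ht x 1) hxR
  have hy' : |y| ≤ |x| + 1 := by simpa using (mem_ball_zero_iff.mp hy).le
  refine (norm_add_le _ _).trans (add_le_add (norm_pow_mul_cexp_sq_le ht hy' 0 m) ?_)
  rw [norm_mul]
  exact mul_le_mul_of_nonneg_left (norm_pow_mul_cexp_sq_le ht hy' 2 m) (norm_nonneg _)

/-- **Termwise differentiation of the Poisson-resummed coherent state overlap.**
For every `t > 0`, the function `G(θ) = (1/sinh θ) Σ_{m∈ℤ} (θ − 2πim) e^{(θ−2πim)²/t}`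
is differentiable at every `θ > 0`, with derivative given by the termwise-differentiated
series `Σ_{m∈ℤ} e^{(θ−2πim)²/t} [2(θ−2πim)²/(t sinh θ) − (θ−2πim) cosh θ/sinh²θ + 1/sinh θ]`,
which converges absolutely for every `θ > 0`. -/
theorem termwise_deriv_poisson_overlap (t : ℝ) (ht : 0 < t) (θ : ℝ) (hθ : 0 < θ) :
    Summable (fun m : ℤ =>
      ‖Complex.exp (((θ : ℂ) - 2 * (π : ℂ) * Complex.I * (m : ℂ)) ^ 2 / (t : ℂ))
        * (2 * ((θ : ℂ) - 2 * (π : ℂ) * Complex.I * (m : ℂ)) ^ 2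
              / ((t : ℂ) * (Real.sinh θ : ℂ))
          - ((θ : ℂ) - 2 * (π : ℂ) * Complex.I * (m : ℂ)) * (Real.cosh θ : ℂ)
              / (Real.sinh θ : ℂ) ^ 2
          + 1 / (Real.sinh θ : ℂ))‖) ∧
    HasDerivAt (fun θ' : ℝ =>
        (1 / (Real.sinh θ' : ℂ))
          * ∑' m : ℤ, ((θ' : ℂ) - 2 * (π : ℂ) * Complex.I * (m : ℂ))
              * Complex.exp (((θ' : ℂ) - 2 * (π : ℂ) * Complex.I * (m : ℂ)) ^ 2 / (t : ℂ)))
      (∑' m : ℤ,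
        Complex.exp (((θ : ℂ) - 2 * (π : ℂ) * Complex.I * (m : ℂ)) ^ 2 / (t : ℂ))
          * (2 * ((θ : ℂ) - 2 * (π : ℂ) * Complex.I * (m : ℂ)) ^ 2
                / ((t : ℂ) * (Real.sinh θ : ℂ))
            - ((θ : ℂ) - 2 * (π : ℂ) * Complex.I * (m : ℂ)) * (Real.cosh θ : ℂ)
                / (Real.sinh θ : ℂ) ^ 2
            + 1 / (Real.sinh θ : ℂ)))
      θ := by
  have hsinh : (Real.sinh θ : ℂ) ≠ 0 := by
    exact_mod_cast (Real.sinh_pos_iff.mpr hθ).ne'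
  have ht' : (t : ℂ) ≠ 0 := by exact_mod_cast ht.ne'
  have h₀ := summable_pow_mul_cexp_sq ht θ 0
  have h₁ := summable_pow_mul_cexp_sq ht θ 1
  have h₂ := summable_pow_mul_cexp_sq ht θ 2
  have hder := h₀.add (h₂.mul_left (2 / (t : ℂ)))
  have hsum := (h₁.hasSum.mul_left (-(Real.cosh θ : ℂ) / (Real.sinh θ : ℂ) ^ 2)).add
    (hder.hasSum.mul_left (1 / (Real.sinh θ : ℂ)))
  have hterm := hsum.congr_fun (g := fun m : ℤ =>
    Complex.exp (((θ : ℂ) - 2 * (π : ℂ) * Complex.I * (m : ℂ)) ^ 2 / (t : ℂ))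
      * (2 * ((θ : ℂ) - 2 * (π : ℂ) * Complex.I * (m : ℂ)) ^ 2 / ((t : ℂ) * (Real.sinh θ : ℂ))
        - ((θ : ℂ) - 2 * (π : ℂ) * Complex.I * (m : ℂ)) * (Real.cosh θ : ℂ)
            / (Real.sinh θ : ℂ) ^ 2
        + 1 / (Real.sinh θ : ℂ))) (fun m => by field_simp; ring)
  refine ⟨hterm.summable.norm, ?_⟩
  have hinv : HasDerivAt (fun y : ℝ => 1 / (Real.sinh y : ℂ))
      (-(Real.cosh θ : ℂ) / (Real.sinh θ : ℂ) ^ 2) θ := by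
    simpa only [one_div] using (Real.hasDerivAt_sinh θ).ofReal_comp.fun_inv hsinh
  rw [hterm.tsum_eq]
  simpa only [pow_one] using hinv.fun_mul (hasDerivAt_tsum_mul_cexp_sq ht θ)
end
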